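/- arXiv:2001.05990 — 8 statements merged into one kernel-verified Lean document; each statement's English description precedes it below -/
import Mathlib

section
/- Let α > 1, ε ≥ 0, δ ∈ (0,1), and let p ∈ (δ,1). Set q := (p−δ)·e^{−ε}, and let P and Q be the Bernoulli distributions on {0,1} with success probabilities p and q respectively. Then q ∈ (0, p), the supremum over all subsets A of {0,1} of (P(A) − e^ε·Q(A)) equals δ, and the Rényi divergence of order α satisfies D_α(P‖Q) = ε + (1/(α−1))·log( p^α·(p−δ)^{1−α} + (1−p)^α·(e^ε − p + δ)^{1−α} ). -/
open MeasureTheory Real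

/-- Rényi divergence of order `α` between `P` and `Q`:
`D_α(P‖Q) := (1/(α−1)) · log ∫ (dP/dQ)^α dQ`. -/
noncomputable def renyiDiv {X : Type*} [MeasurableSpace X] (α : ℝ) (P Q : Measure X) : ℝ :=
  (1 / (α - 1)) * Real.log (∫ x, ((P.rnDeriv Q x).toReal) ^ α ∂Q)

/-- The Bernoulli distribution on `{0,1}` (modelled as `Bool`, with `true ↔ 1`)
with success probability `p`. -/
noncomputable def bernoulliMeasure (p : ℝ) : Measure Bool :=
  (ENNReal.ofReal p) • Measure.dirac true + (ENNReal.ofReal (1 - p)) • Measure.dirac false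

instance bernoulliMeasure.instIsFiniteMeasure (p : ℝ) : IsFiniteMeasure (bernoulliMeasure p) := by
  refine ⟨?_⟩
  simp [bernoulliMeasure]

open Classical in
lemma toReal_bernoulliMeasure_apply {p : ℝ} (h0 : 0 ≤ p) (h1 : p ≤ 1) (A : Set Bool) :
    (bernoulliMeasure p A).toReal
      = (if true ∈ A then p else 0) + (if false ∈ A then 1 - p else 0) := by
  have h : 0 ≤ 1 - p := by linarith
  by_cases ht : true ∈ A <;> by_cases hf : false ∈ A <;>
    simp [bernoulliMeasure, ht, hf, ENNReal.toReal_add, h0, h]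

lemma absolutelyContinuous_bernoulliMeasure (p : ℝ) {q : ℝ} (h0 : 0 < q) (h1 : q < 1) :
    bernoulliMeasure p ≪ bernoulliMeasure q := by
  intro A hA
  have h := toReal_bernoulliMeasure_apply h0.le h1.le A
  rw [hA] at h
  by_cases ht : true ∈ A <;> by_cases hf : false ∈ A <;> simp [ht, hf] at h
  · linarith
  · linarith
  · simp [bernoulliMeasure, ht, hf]

lemma rnDeriv_mul_measure_singleton {X : Type*} [MeasurableSpace X] [MeasurableSingletonClass X]
    {P Q : Measure X} [SigmaFinite P] [SigmaFinite Q] (h : P ≪ Q) (x : X) :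
    P.rnDeriv Q x * Q {x} = P {x} := by
  rw [← lintegral_singleton (P.rnDeriv Q) x, Measure.setLIntegral_rnDeriv h]

/-- The Rényi divergence between two Bernoulli distributions, in closed form. -/
lemma renyiDiv_bernoulliMeasure (α : ℝ) {p q : ℝ} (hp0 : 0 ≤ p) (hp1 : p ≤ 1)
    (hq0 : 0 < q) (hq1 : q < 1) :
    renyiDiv α (bernoulliMeasure p) (bernoulliMeasure q)
      = (1 / (α - 1)) *
        Real.log (p ^ α * q ^ (1 - α) + (1 - p) ^ α * (1 - q) ^ (1 - α)) := by
  have hac := absolutelyContinuous_bernoulliMeasure p hq0 hq1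
  have key (b : Bool) := congrArg ENNReal.toReal (rnDeriv_mul_measure_singleton hac b)
  simp only [ENNReal.toReal_mul, toReal_bernoulliMeasure_apply hq0.le hq1.le,
    toReal_bernoulliMeasure_apply hp0 hp1] at key
  have hq1' : 0 < 1 - q := by linarith
  have ht := eq_div_of_mul_eq hq0.ne' (by simpa using key true)
  have hf := eq_div_of_mul_eq hq1'.ne' (by simpa using key false)
  rw [renyiDiv, integral_fintype (Integrable.of_finite)]
  simp only [Fintype.sum_bool, Measure.real, toReal_bernoulliMeasure_apply hq0.le hq1.le, ht, hf]
  rw [div_rpow hp0 hq0.le, div_rpow (by linarith) hq1'.le, rpow_sub hq0, rpow_sub hq1']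
  simp only [rpow_one, smul_eq_mul, Set.mem_singleton_iff, if_true, reduceCtorEq, if_false]
  congr 2
  ring

theorem stmt1 (α ε δ : ℝ) (hα : 1 < α) (hε : 0 ≤ ε) (hδ : δ ∈ Set.Ioo (0 : ℝ) 1)
    (p : ℝ) (hp : p ∈ Set.Ioo δ 1)
    (q : ℝ) (hq : q = (p - δ) * Real.exp (-ε))
    (P Q : Measure Bool) (hP : P = bernoulliMeasure p) (hQ : Q = bernoulliMeasure q) :
    q ∈ Set.Ioo 0 p ∧
    (⨆ A : Set Bool, ((P A).toReal - Real.exp ε * (Q A).toReal)) = δ ∧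
    renyiDiv α P Q =
      ε + (1 / (α - 1)) *
        Real.log (p ^ α * (p - δ) ^ (1 - α)
          + (1 - p) ^ α * (Real.exp ε - p + δ) ^ (1 - α)) := by
  obtain ⟨hδ0, hδ1⟩ := hδ
  obtain ⟨hpδ, hp1⟩ := hp
  have hp0 : 0 < p := hδ0.trans hpδ
  have hd : 0 < p - δ := sub_pos.2 hpδ
  have hexp : 1 ≤ exp ε := one_le_exp hε
  have hexpq : exp ε * q = p - δ := by
    rw [hq, mul_left_comm, ← exp_add, add_neg_cancel, exp_zero, mul_one]
  have hq0 : 0 < q := hq ▸ mul_pos hd (exp_pos _)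
  have hqp : q < p := by nlinarith
  have hq1 : q < 1 := hqp.trans hp1
  subst hP hQ
  refine ⟨⟨hq0, hqp⟩, ?_, ?_⟩
  · classical
    have hval (A : Set Bool) := toReal_bernoulliMeasure_apply hp0.le hp1.le A
    have hval' (A : Set Bool) := toReal_bernoulliMeasure_apply hq0.le hq1.le A
    refine IsLUB.ciSup_eq (IsGreatest.isLUB ⟨⟨{true}, ?_⟩, ?_⟩)
    · simp only [hval, hval']
      simp [hexpq]
    · rintro _ ⟨A, rfl⟩
      simp only [hval, hval']
      split_ifs <;> nlinarith
  · have hr : 0 < exp ε - p + δ := by linarith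
    have h1q : 1 - q = (exp ε - p + δ) * exp (-ε) := by
      rw [hq, exp_neg]
      field_simp
      ring
    have hpos : 0 < p ^ α * (p - δ) ^ (1 - α) + (1 - p) ^ α * (exp ε - p + δ) ^ (1 - α) := by
      have : 0 < 1 - p := by linarith
      positivity
    have hsplit : p ^ α * q ^ (1 - α) + (1 - p) ^ α * (1 - q) ^ (1 - α)
        = exp (-ε * (1 - α)) *
          (p ^ α * (p - δ) ^ (1 - α) + (1 - p) ^ α * (exp ε - p + δ) ^ (1 - α)) := by
      rw [h1q, hq, mul_rpow hd.le (exp_pos _).le, mul_rpow hr.le (exp_pos _).le, ← exp_mul]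
      ring
    have hα' : α - 1 ≠ 0 := by linarith
    rw [renyiDiv_bernoulliMeasure α hp0.le hp1.le hq0 hq1, hsplit,
      log_mul (exp_pos _).ne' hpos.ne', log_exp]
    field_simp
    ring
end

section
/- Let α > 1, ε ≥ 0 and δ ∈ (0,1) with α·δ ≥ 1. Then inf_{p ∈ (δ,1)} ( p^α·(p−δ)^{1−α} + (1−p)^α·(e^ε − p + δ)^{1−α} ) = (1−δ)^{1−α}. -/
open Real

theorem one_sub_rpow_le_rpow_mul_sub_rpow {α δ p : ℝ} (hα : 1 < α) (hαδ : 1 ≤ α * δ)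
    (hδp : δ < p) (hp : p < 1) :
    (1 - δ) ^ (1 - α) ≤ p ^ α * (p - δ) ^ (1 - α) := by
  have hα0 : 0 < α := by linarith
  have hδ : α⁻¹ ≤ δ := by rwa [inv_le_iff_one_le_mul₀' hα0]
  have h1 : 0 < 1 - δ := by linarith
  have h2 : 0 < p - δ := by linarith
  have hx : 0 < (p - δ) / (1 - δ) := by positivity
  have hx1 : (p - δ) / (1 - δ) < 1 := by rw [div_lt_one h1]; linarith
  have hpx : p = δ + (1 - δ) * ((p - δ) / (1 - δ)) := by field_simp; ring
  have bernoulli := rpow_one_add_le_one_add_mul_self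
    (s := (p - δ) / (1 - δ) - 1) (by linarith) (p := 1 - α⁻¹)
    (sub_nonneg.2 (inv_le_one_of_one_le₀ hα.le)) (by simp [hα0.le])
  rw [add_sub_cancel] at bernoulli
  have root_le : ((p - δ) / (1 - δ)) ^ (1 - α⁻¹) ≤ p := by nlinarith
  have pow_le := rpow_le_rpow (by positivity) root_le hα0.le
  rw [← rpow_mul hx.le, sub_mul, inv_mul_cancel₀ hα0.ne', one_mul,
    div_rpow h2.le h1.le] at pow_le
  calc (1 - δ) ^ (1 - α)
      = (p - δ) ^ (α - 1) / (1 - δ) ^ (α - 1) * (p - δ) ^ (1 - α) := by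
        rw [← neg_sub α 1, rpow_neg h1.le, rpow_neg h2.le]
        have := rpow_pos_of_pos h1 (α - 1)
        have := rpow_pos_of_pos h2 (α - 1)
        field_simp
    _ ≤ p ^ α * (p - δ) ^ (1 - α) := by gcongr

theorem stmt2 (α ε δ : ℝ) (hα : 1 < α) (hε : 0 ≤ ε) (hδ : δ ∈ Set.Ioo (0 : ℝ) 1)
    (hαδ : α * δ ≥ 1) :
    (⨅ p : Set.Ioo δ 1, ((p : ℝ) ^ α * ((p : ℝ) - δ) ^ (1 - α)
      + (1 - (p : ℝ)) ^ α * (Real.exp ε - (p : ℝ) + δ) ^ (1 - α)))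
      = (1 - δ) ^ (1 - α) := by
  obtain ⟨hδ0, hδ1⟩ := hδ
  have hexp : 1 ≤ exp ε := one_le_exp hε
  have : Nonempty (Set.Ioo δ 1) := (Set.nonempty_Ioo.2 hδ1).to_subtype
  have lower : ∀ p : Set.Ioo δ 1, (1 - δ) ^ (1 - α) ≤ (p : ℝ) ^ α * ((p : ℝ) - δ) ^ (1 - α)
      + (1 - (p : ℝ)) ^ α * (exp ε - (p : ℝ) + δ) ^ (1 - α) := by
    rintro ⟨p, hδp, hp⟩
    have h1 : 0 ≤ 1 - p := by linarith
    have h2 : 0 ≤ exp ε - p + δ := by linarith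
    exact (one_sub_rpow_le_rpow_mul_sub_rpow hα hαδ hδp hp).trans
      (le_add_of_nonneg_right (by positivity))
  refine le_antisymm ?_ (le_ciInf lower)
  have cont : ContinuousAt (fun p : ℝ ↦ p ^ α * (p - δ) ^ (1 - α)
      + (1 - p) ^ α * (exp ε - p + δ) ^ (1 - α)) 1 := by
    have h1 : (1 : ℝ) - δ ≠ 0 := by linarith
    have h2 : exp ε - 1 + δ ≠ 0 := by linarith
    refine .add (.mul ?_ ?_) (.mul ?_ ?_)
    · exact continuousAt_id.rpow_const (.inr (by linarith))
    · exact ContinuousAt.rpow_const (by fun_prop) (.inl h1)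
    · exact ContinuousAt.rpow_const (by fun_prop) (.inr (by linarith))
    · exact ContinuousAt.rpow_const (by fun_prop) (.inl h2)
  have lim := cont.tendsto.mono_left (nhdsWithin_le_nhds (s := Set.Iio 1))
  simp only [one_rpow, one_mul, sub_self, zero_rpow (show α ≠ 0 by linarith), zero_mul,
    add_zero] at lim
  refine ge_of_tendsto lim ?_
  filter_upwards [Ioo_mem_nhdsLT hδ1] with p hp
  exact ciInf_le ⟨_, Set.forall_mem_range.2 lower⟩ (⟨p, hp⟩ : Set.Ioo δ 1)
end

section
/- Let ε ≥ 0 and δ ∈ (0,1). Then sup_{α > 1} ( ε/α + (1/(α·(α−1)))·log δ ) = ε − 2·log δ − 2·√((ε − log δ)·log(1/δ)). -/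
open Real

/-- Every value of `a² / α - b² / (α - 1)` on `α > 1` is at most `(a - b)²`. -/
lemma sub_sq_div_le_sub_sq (a b : ℝ) {α : ℝ} (hα : 1 < α) :
    a ^ 2 / α - b ^ 2 / (α - 1) ≤ (a - b) ^ 2 := by
  have h0 : 0 < α := by linarith
  have h1 : 0 < α - 1 := by linarith
  have h : (a - b) ^ 2 - (a ^ 2 / α - b ^ 2 / (α - 1))
      = (a * (α - 1) - b * α) ^ 2 / (α * (α - 1)) := by
    field_simp
    ring
  have : 0 ≤ (a * (α - 1) - b * α) ^ 2 / (α * (α - 1)) := by positivity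
  linarith

/-- The bound `(a - b)²` is approached by `a² / α - b² / (α - 1)` on `α > 1`; it is attained at
`α = a / (a - b)` if `b < a`, and only in the limit `α → ∞` if `a = b`. -/
lemma exists_lt_sub_sq_div {a b w : ℝ} (hb : 0 < b) (hba : b ≤ a) (hw : w < (a - b) ^ 2) :
    ∃ α : ℝ, 1 < α ∧ w < a ^ 2 / α - b ^ 2 / (α - 1) := by
  rcases hba.eq_or_lt with rfl | hlt
  · have hw' : 0 < -w := by simpa using hw
    have hq : 0 < b ^ 2 / -w := by positivity
    refine ⟨2 + b ^ 2 / -w, by linarith, ?_⟩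
    set α := 2 + b ^ 2 / -w with hα
    have h0 : 0 < α := by linarith
    have h1 : 0 < α - 1 := by linarith
    have h : b ^ 2 / α - b ^ 2 / (α - 1) = -(b ^ 2 / (α * (α - 1))) := by
      field_simp
      ring
    have hlt : b ^ 2 / (α * (α - 1)) < -w := by
      rw [div_lt_comm₀ (by positivity) hw']
      nlinarith
    linarith
  · have hab : 0 < a - b := by linarith
    have ha : 0 < a := by linarith
    refine ⟨a / (a - b), by rw [one_lt_div hab]; linarith, ?_⟩
    have h1 : a / (a - b) - 1 = b / (a - b) := by
      field_simp
      ring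
    have h : a ^ 2 / (a / (a - b)) - b ^ 2 / (a / (a - b) - 1) = (a - b) ^ 2 := by
      rw [h1]
      field_simp
    rwa [h]

theorem stmt10 (ε δ : ℝ) (hε : 0 ≤ ε) (hδ : δ ∈ Set.Ioo (0 : ℝ) 1) :
    (⨆ α : Set.Ioi (1 : ℝ), (ε / (α : ℝ) + (1 / ((α : ℝ) * ((α : ℝ) - 1))) * Real.log δ))
      = ε - 2 * Real.log δ - 2 * Real.sqrt ((ε - Real.log δ) * Real.log (1 / δ)) := by
  have hL : Real.log δ < 0 := Real.log_neg hδ.1 hδ.2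
  set a := √(ε - Real.log δ)
  set b := √(-Real.log δ)
  have ha : a ^ 2 = ε - Real.log δ := Real.sq_sqrt (by linarith)
  have hb : b ^ 2 = -Real.log δ := Real.sq_sqrt (by linarith)
  have hb0 : 0 < b := Real.sqrt_pos.2 (by linarith)
  have hba : b ≤ a := Real.sqrt_le_sqrt (by linarith)
  have hrhs : ε - 2 * Real.log δ - 2 * √((ε - Real.log δ) * Real.log (1 / δ)) = (a - b) ^ 2 := by
    rw [one_div, Real.log_inv, Real.sqrt_mul (by linarith)]
    linear_combination -ha - hb
  have hf (α : ℝ) (hα : 1 < α) : ε / α + 1 / (α * (α - 1)) * Real.log δ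
      = a ^ 2 / α - b ^ 2 / (α - 1) := by
    have h0 : α ≠ 0 := by linarith
    have h1 : α - 1 ≠ 0 := by linarith
    rw [ha, hb]
    field_simp
    ring
  have : Nonempty (Set.Ioi (1 : ℝ)) := ⟨⟨2, by simp⟩⟩
  rw [hrhs]
  refine ciSup_eq_of_forall_le_of_forall_lt_exists_gt (fun α ↦ ?_) fun w hw ↦ ?_
  · rw [hf α α.2]
    exact sub_sq_div_le_sub_sq a b α.2
  · obtain ⟨α, hα, h⟩ := exists_lt_sub_sq_div hb0 hba hw
    exact ⟨⟨α, hα⟩, by rwa [hf α hα]⟩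
end

section
/- Let α > 1 and p ∈ (0,1). Then the function q ↦ p^α·q^{1−α} + (1−p)^α·(1−q)^{1−α} is strictly decreasing on the interval (0, p). -/
open Real

theorem stmt12 (α p : ℝ) (hα : 1 < α) (hp : p ∈ Set.Ioo (0 : ℝ) 1) :
    StrictAntiOn (fun q : ℝ => p ^ α * q ^ (1 - α) + (1 - p) ^ α * (1 - q) ^ (1 - α))
      (Set.Ioo 0 p) := by
  obtain ⟨hp0, hp1⟩ := hp
  have hderiv : ∀ q ∈ Set.Ioo 0 p,
      HasDerivAt (fun q : ℝ => p ^ α * q ^ (1 - α) + (1 - p) ^ α * (1 - q) ^ (1 - α))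
        ((1 - α) * ((p / q) ^ α - ((1 - p) / (1 - q)) ^ α)) q := by
    rintro q ⟨hq0, hqp⟩
    have hq1 : 0 < 1 - q := by linarith
    have h₁ := ((hasDerivAt_id q).rpow_const (p := 1 - α) (Or.inl hq0.ne')).const_mul (p ^ α)
    have h₂ := (((hasDerivAt_id q).const_sub 1).rpow_const (p := 1 - α)
      (Or.inl hq1.ne')).const_mul ((1 - p) ^ α)
    refine (h₁.add h₂).congr_deriv ?_
    rw [div_rpow hp0.le hq0.le, div_rpow (by linarith) hq1.le,
      show 1 - α - 1 = -α by ring, id_eq, rpow_neg hq0.le, rpow_neg hq1.le]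
    ring
  refine strictAntiOn_of_deriv_neg (convex_Ioo 0 p)
    (fun q hq => (hderiv q hq).continuousAt.continuousWithinAt) fun q hq => ?_
  rw [interior_Ioo] at hq
  rw [(hderiv q hq).deriv]
  obtain ⟨hq0, hqp⟩ := hq
  have hq1 : 0 < 1 - q := by linarith
  refine mul_neg_of_neg_of_pos (by linarith) (sub_pos.2 ?_)
  refine rpow_lt_rpow (div_nonneg (by linarith) hq1.le) ?_ (by linarith)
  rw [div_lt_div_iff₀ hq1 hq0]
  linarith
end

section
/- Let α > 1 and ε ≥ 0. Then the function δ ↦ inf{ (p^α·q^{1−α} + (1−p)^α·(1−q)^{1−α} − 1)/(α−1) : p, q ∈ (0,1), p − e^ε·q ≥ δ } is convex on [0,1). -/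
/-- The perspective `q * (p / q) ^ α` of the power function, in product form. -/
lemma rpow_mul_rpow_one_sub_eq {α p q : ℝ} (hp : 0 ≤ p) (hq : 0 < q) :
    p ^ α * q ^ (1 - α) = q * (p / q) ^ α := by
  rw [Real.div_rpow hp hq.le, Real.rpow_sub hq, Real.rpow_one]
  ring

/-- Joint convexity of `(p, q) ↦ p ^ α * q ^ (1 - α)` for `1 ≤ α`. -/
lemma rpow_mul_rpow_one_sub_convex {α p₁ q₁ p₂ q₂ a b : ℝ} (hα : 1 ≤ α)
    (hp₁ : 0 ≤ p₁) (hq₁ : 0 < q₁) (hp₂ : 0 ≤ p₂) (hq₂ : 0 < q₂)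
    (ha : 0 ≤ a) (hb : 0 ≤ b) (hab : a + b = 1) :
    (a * p₁ + b * p₂) ^ α * (a * q₁ + b * q₂) ^ (1 - α) ≤
      a * (p₁ ^ α * q₁ ^ (1 - α)) + b * (p₂ ^ α * q₂ ^ (1 - α)) := by
  have hQ : 0 < a * q₁ + b * q₂ := convex_Ioi (0 : ℝ) hq₁ hq₂ ha hb hab
  rw [rpow_mul_rpow_one_sub_eq (by positivity) hQ, rpow_mul_rpow_one_sub_eq hp₁ hq₁,
    rpow_mul_rpow_one_sub_eq hp₂ hq₂]
  have hsum : a * q₁ / (a * q₁ + b * q₂) + b * q₂ / (a * q₁ + b * q₂) = 1 := by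
    rw [← add_div, div_self hQ.ne']
  have h := (convexOn_rpow hα).2 (Set.mem_Ici.2 (div_nonneg hp₁ hq₁.le))
    (Set.mem_Ici.2 (div_nonneg hp₂ hq₂.le))
    (div_nonneg (mul_nonneg ha hq₁.le) hQ.le) (div_nonneg (mul_nonneg hb hq₂.le) hQ.le) hsum
  simp only [smul_eq_mul] at h
  have hmean : a * q₁ / (a * q₁ + b * q₂) * (p₁ / q₁) + b * q₂ / (a * q₁ + b * q₂) * (p₂ / q₂) =
      (a * p₁ + b * p₂) / (a * q₁ + b * q₂) := by
    field_simp
  rw [hmean] at h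
  calc (a * q₁ + b * q₂) * ((a * p₁ + b * p₂) / (a * q₁ + b * q₂)) ^ α
      ≤ (a * q₁ + b * q₂) * (a * q₁ / (a * q₁ + b * q₂) * (p₁ / q₁) ^ α +
          b * q₂ / (a * q₁ + b * q₂) * (p₂ / q₂) ^ α) := mul_le_mul_of_nonneg_left h hQ.le
    _ = a * (q₁ * (p₁ / q₁) ^ α) + b * (q₂ * (p₂ / q₂) ^ α) := by
        field_simp

/-- The infimum of a family of nonempty sets of reals, bounded below, is convex in the parameter
as soon as convex combinations of values are dominated by convex combinations of parameters. -/
lemma convexOn_sInf_of_exists_le {s : Set ℝ} (hs : Convex ℝ s) {S : ℝ → Set ℝ}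
    (hne : ∀ x ∈ s, (S x).Nonempty) (hbdd : ∀ x, BddBelow (S x))
    (h : ∀ x ∈ s, ∀ y ∈ s, ∀ a b : ℝ, 0 ≤ a → 0 ≤ b → a + b = 1 →
      ∀ u ∈ S x, ∀ v ∈ S y, ∃ w ∈ S (a * x + b * y), w ≤ a * u + b * v) :
    ConvexOn ℝ s (fun x => sInf (S x)) := by
  refine ⟨hs, fun x hx y hy a b ha hb hab => ?_⟩
  simp only [smul_eq_mul]
  refine le_of_forall_pos_le_add fun η hη => ?_
  obtain ⟨u, hu, hu'⟩ := exists_lt_of_csInf_lt (hne x hx) (lt_add_of_pos_right (sInf (S x)) hη)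
  obtain ⟨v, hv, hv'⟩ := exists_lt_of_csInf_lt (hne y hy) (lt_add_of_pos_right (sInf (S y)) hη)
  obtain ⟨w, hw, hw'⟩ := h x hx y hy a b ha hb hab u hu v hv
  calc sInf (S (a * x + b * y)) ≤ w := csInf_le (hbdd _) hw
    _ ≤ a * u + b * v := hw'
    _ ≤ a * (sInf (S x) + η) + b * (sInf (S y) + η) := by gcongr
    _ = a * sInf (S x) + b * sInf (S y) + η := by linear_combination η * hab

theorem stmt13 (α ε : ℝ) (hα : 1 < α) (hε : 0 ≤ ε) :
    ConvexOn ℝ (Set.Ico (0 : ℝ) 1) (fun δ : ℝ =>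
      sInf {y : ℝ | ∃ p q : ℝ, p ∈ Set.Ioo (0 : ℝ) 1 ∧ q ∈ Set.Ioo (0 : ℝ) 1 ∧
        p - Real.exp ε * q ≥ δ ∧
        y = (p ^ α * q ^ (1 - α) + (1 - p) ^ α * (1 - q) ^ (1 - α) - 1) / (α - 1)}) := by
  have hα' : 0 < α - 1 := sub_pos.2 hα
  refine convexOn_sInf_of_exists_le (convex_Ico 0 1) ?_ ?_ ?_
  · rintro δ ⟨hδ₀, hδ₁⟩
    have hexp : 1 ≤ Real.exp ε := Real.one_le_exp hε
    refine ⟨_, (1 + δ) / 2, (1 - δ) / 2 / Real.exp ε, ⟨by linarith, by linarith⟩,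
      ⟨div_pos (by linarith) (by positivity), ?_⟩, ?_, rfl⟩
    · rw [div_lt_one (by positivity)]
      linarith
    · rw [mul_div_cancel₀ _ (Real.exp_pos ε).ne']
      linarith
  · refine fun δ => ⟨-1 / (α - 1), ?_⟩
    rintro _ ⟨p, q, ⟨hp₀, hp₁⟩, ⟨hq₀, hq₁⟩, -, rfl⟩
    have h₁ : 0 ≤ p ^ α * q ^ (1 - α) := by positivity
    have h₂ : 0 ≤ (1 - p) ^ α * (1 - q) ^ (1 - α) :=
      mul_nonneg (Real.rpow_nonneg (by linarith) _) (Real.rpow_nonneg (by linarith) _)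
    gcongr
    linarith
  · rintro x - y - a b ha hb hab _ ⟨p₁, q₁, hp₁, hq₁, h₁, rfl⟩ _ ⟨p₂, q₂, hp₂, hq₂, h₂, rfl⟩
    refine ⟨_, ⟨a * p₁ + b * p₂, a * q₁ + b * q₂, convex_Ioo 0 1 hp₁ hp₂ ha hb hab,
      convex_Ioo 0 1 hq₁ hq₂ ha hb hab, ?_, rfl⟩, ?_⟩
    · have := add_le_add (mul_le_mul_of_nonneg_left h₁ ha) (mul_le_mul_of_nonneg_left h₂ hb)
      linarith
    · have hpq := rpow_mul_rpow_one_sub_convex hα.le hp₁.1.le hq₁.1 hp₂.1.le hq₂.1 ha hb hab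
      have hpq' := rpow_mul_rpow_one_sub_convex hα.le (sub_nonneg.2 hp₁.2.le) (sub_pos.2 hq₁.2)
        (sub_nonneg.2 hp₂.2.le) (sub_pos.2 hq₂.2) ha hb hab
      have hp : a * (1 - p₁) + b * (1 - p₂) = 1 - (a * p₁ + b * p₂) := by
        linear_combination hab
      have hq : a * (1 - q₁) + b * (1 - q₂) = 1 - (a * q₁ + b * q₂) := by
        linear_combination hab
      rw [hp, hq] at hpq'
      rw [← mul_div_assoc, ← mul_div_assoc, ← add_div]
      gcongr
      linarith
end

section
/- Let α > 1, δ ∈ [0,1), ε ≥ 0 and p ∈ (δ,1). Then p^α·(p−δ)^{1−α} + (1−p)^α·(e^ε − p + δ)^{1−α} ≥ α·δ + ((1−δ)/(e^ε−δ))^α·(e^ε − α·δ). -/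
open Real

/-- The homogeneous function `a ^ α * b ^ (1 - α)` lies above its tangent plane along the ray
`a = x * b`. -/
theorem tangent_le_rpow_mul_rpow_one_sub {α a b x : ℝ} (hα : 1 ≤ α) (ha : 0 ≤ a) (hb : 0 < b)
    (hx : 0 < x) :
    α * x ^ (α - 1) * a - (α - 1) * x ^ α * b ≤ a ^ α * b ^ (1 - α) := by
  have bernoulli : 1 + α * (a / (b * x) - 1) ≤ (1 + (a / (b * x) - 1)) ^ α :=
    one_add_mul_self_le_rpow_one_add (by linarith [show 0 ≤ a / (b * x) by positivity]) hα
  rw [add_sub_cancel, div_rpow ha (by positivity), mul_rpow hb.le hx.le] at bernoulli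
  have hxα : 0 < x ^ α := rpow_pos_of_pos hx α
  have hbα : 0 < b ^ α := rpow_pos_of_pos hb α
  rw [rpow_sub hx, rpow_sub hb, rpow_one, rpow_one]
  calc
    _ = (1 + α * (a / (b * x) - 1)) * (b * x ^ α) := by field_simp; ring
    _ ≤ a ^ α / (b ^ α * x ^ α) * (b * x ^ α) := by gcongr
    _ = _ := by field_simp

theorem stmt15 (α δ ε p : ℝ) (hα : 1 < α) (hδ : δ ∈ Set.Ico (0 : ℝ) 1) (hε : 0 ≤ ε)
    (hp : p ∈ Set.Ioo δ 1) :
    p ^ α * (p - δ) ^ (1 - α) + (1 - p) ^ α * (Real.exp ε - p + δ) ^ (1 - α)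
      ≥ α * δ + ((1 - δ) / (Real.exp ε - δ)) ^ α * (Real.exp ε - α * δ) := by
  obtain ⟨hδ0, hδ1⟩ := hδ
  obtain ⟨hδp, hp1⟩ := hp
  have hE : 1 ≤ exp ε := one_le_exp hε
  have hEδ : 0 < exp ε - δ := by linarith
  set r := (1 - δ) / (exp ε - δ) with hr
  have hr0 : 0 < r := div_pos (by linarith) hEδ
  have first := tangent_le_rpow_mul_rpow_one_sub hα.le (a := p) (b := p - δ) (by linarith)
    (by linarith) one_pos
  have second := tangent_le_rpow_mul_rpow_one_sub hα.le (a := 1 - p) (b := exp ε - p + δ)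
    (by linarith) (by linarith) hr0
  have slope := tangent_le_rpow_mul_rpow_one_sub hα.le zero_le_one one_pos hr0
  simp only [one_rpow, mul_one] at first slope
  have hrα : r ^ α * (exp ε - δ) = r ^ (α - 1) * (1 - δ) := by
    rw [rpow_sub_one hr0.ne', show 1 - δ = r * (exp ε - δ) by rw [hr]; field_simp]
    field_simp
  linear_combination first + second + (p - δ) * slope + α * hrα
end

section
/- Let α > 1 and ε ≥ 0. Then the function δ ↦ (e^ε − α·δ)·((1−δ)/(e^ε−δ))^α + α·δ is convex on the interval [0, min{1, e^ε·(e^ε+1)/(2·e^ε + α·(e^ε−1))}). -/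
open Real

/-- The derivative of `x ↦ ((1 - x) / (E - x)) ^ α`, in logarithmic form. -/
theorem hasDerivAt_ratio_rpow {α E x : ℝ} (hE : 1 ≤ E) (hx : x < 1) :
    HasDerivAt (fun t : ℝ => ((1 - t) / (E - t)) ^ α)
      (-(α * (E - 1)) * ((1 - x) / (E - x)) ^ α / ((1 - x) * (E - x))) x := by
  have h1 : 0 < 1 - x := by linarith
  have h2 : 0 < E - x := by linarith
  have hu : HasDerivAt (fun t : ℝ => (1 - t) / (E - t)) _ x :=
    ((hasDerivAt_id x).const_sub 1).div ((hasDerivAt_id x).const_sub E) h2.ne'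
  have hu_pos : 0 < (1 - x) / (E - x) := div_pos h1 h2
  convert hu.rpow_const (p := α) (Or.inl hu_pos.ne') using 1
  rw [rpow_sub_one hu_pos.ne']
  simp only [id]
  field_simp
  ring

/-- The second derivative factors with the sign of `E * (E + 1) - x * (2 * E + α * (E - 1))`. -/
theorem hasDerivAt_deriv_ratio_rpow {α E x : ℝ} (hE : 1 ≤ E) (hx : x < 1) :
    HasDerivAt (fun t : ℝ => -α * ((1 - t) / (E - t)) ^ α +
        (E - α * t) * (-(α * (E - 1)) * ((1 - t) / (E - t)) ^ α / ((1 - t) * (E - t))) + α)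
      (α * (E - 1) * ((1 - x) / (E - x)) ^ α / ((1 - x) * (E - x)) ^ 2 *
        ((α - 1) * (E * (E + 1) - x * (2 * E + α * (E - 1))))) x := by
  have h1 : 0 < 1 - x := by linarith
  have h2 : 0 < E - x := by linarith
  have hw := hasDerivAt_ratio_rpow (α := α) hE hx
  have hP : HasDerivAt (fun t : ℝ => (1 - t) * (E - t)) _ x :=
    ((hasDerivAt_id x).const_sub 1).mul ((hasDerivAt_id x).const_sub E)
  have hl : HasDerivAt (fun t : ℝ => E - α * t) _ x :=
    ((hasDerivAt_id x).const_mul α).const_sub E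
  refine (((hw.const_mul (-α)).add
    (hl.mul ((hw.const_mul (-(α * (E - 1)))).div hP (mul_pos h1 h2).ne'))).add_const
      α).congr_deriv ?_
  simp only [id, Pi.div_apply]
  generalize ((1 - x) / (E - x)) ^ α = w
  field_simp
  ring

theorem stmt18 (α ε : ℝ) (hα : 1 < α) (hε : 0 ≤ ε) :
    ConvexOn ℝ
      (Set.Ico (0 : ℝ)
        (min 1 (Real.exp ε * (Real.exp ε + 1) / (2 * Real.exp ε + α * (Real.exp ε - 1)))))
      (fun δ : ℝ =>
        (Real.exp ε - α * δ) * ((1 - δ) / (Real.exp ε - δ)) ^ α + α * δ) := by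
  have hE : 1 ≤ Real.exp ε := one_le_exp hε
  generalize Real.exp ε = E at hE ⊢
  have hk : 0 ≤ E - 1 := by linarith
  have hD : 0 < 2 * E + α * (E - 1) := by positivity
  have hf : ∀ x < 1, HasDerivAt (fun δ : ℝ => (E - α * δ) * ((1 - δ) / (E - δ)) ^ α + α * δ)
      (-α * ((1 - x) / (E - x)) ^ α +
        (E - α * x) * (-(α * (E - 1)) * ((1 - x) / (E - x)) ^ α / ((1 - x) * (E - x))) + α) x := by
    intro x hx
    have hlin : HasDerivAt (fun t : ℝ => α * t) _ x := (hasDerivAt_id x).const_mul α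
    refine (((hlin.const_sub E).mul (hasDerivAt_ratio_rpow hE hx)).add hlin).congr_deriv ?_
    simp
  refine convexOn_of_hasDerivWithinAt2_nonneg (convex_Ico _ _)
    (fun x hx => (hf x (lt_min_iff.1 hx.2).1).continuousAt.continuousWithinAt)
    (fun x hx => (hf x (lt_min_iff.1 (interior_subset hx).2).1).hasDerivWithinAt)
    (fun x hx => (hasDerivAt_deriv_ratio_rpow hE
      (lt_min_iff.1 (interior_subset hx).2).1).hasDerivWithinAt) fun x hx => ?_
  obtain ⟨hx1, hx2⟩ := lt_min_iff.1 (interior_subset hx).2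
  rw [lt_div_iff₀ hD] at hx2
  have h1 : 0 ≤ 1 - x := by linarith
  have h2 : 0 ≤ E - x := by linarith
  have h3 : 0 ≤ α - 1 := by linarith
  have h4 : 0 ≤ E * (E + 1) - x * (2 * E + α * (E - 1)) := by linarith
  positivity
end

section
/- Let α > 1, μ₁, μ₂ ∈ ℝ and σ > 0. Let P and Q be the Gaussian measures on ℝ with means μ₁ and μ₂ respectively and common variance σ². Then P is absolutely continuous with respect to Q and the Rényi divergence of order α satisfies D_α(P‖Q) = α·(μ₁ − μ₂)²/(2σ²). -/
open MeasureTheory Real ProbabilityTheory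

open scoped NNReal in
lemma gaussianReal_eq_withDensity_exp (μ₁ μ₂ : ℝ) {v : ℝ≥0} (hv : v ≠ 0) :
    gaussianReal μ₁ v = (gaussianReal μ₂ v).withDensity fun x ↦
      ENNReal.ofReal (exp ((μ₁ - μ₂) / v * x - (μ₁ ^ 2 - μ₂ ^ 2) / (2 * v))) := by
  rw [gaussianReal_of_var_ne_zero _ hv, gaussianReal_of_var_ne_zero _ hv,
    ← withDensity_mul _ (measurable_gaussianPDF μ₂ v) (by fun_prop)]
  congr 1
  ext x
  have hv' : (v : ℝ) ≠ 0 := by exact_mod_cast hv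
  rw [Pi.mul_apply, gaussianPDF, gaussianPDF,
    ← ENNReal.ofReal_mul (gaussianPDFReal_nonneg μ₂ v x), gaussianPDFReal, gaussianPDFReal,
    mul_assoc (√(2 * π * v))⁻¹, ← exp_add]
  congr 3
  field_simp
  ring

open scoped NNReal in
lemma renyiDiv_gaussianReal {α : ℝ} (hα : α ≠ 1) (μ₁ μ₂ : ℝ) {v : ℝ≥0} (hv : v ≠ 0) :
    renyiDiv α (gaussianReal μ₁ v) (gaussianReal μ₂ v) = α * (μ₁ - μ₂) ^ 2 / (2 * v) := by
  have hv' : (v : ℝ) ≠ 0 := by exact_mod_cast hv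
  have hα' : α - 1 ≠ 0 := sub_ne_zero.mpr hα
  have hderiv : (fun x ↦ ((gaussianReal μ₁ v).rnDeriv (gaussianReal μ₂ v) x).toReal ^ α)
      =ᵐ[gaussianReal μ₂ v] fun x ↦
        exp (-(α * ((μ₁ ^ 2 - μ₂ ^ 2) / (2 * v)))) * exp (α * ((μ₁ - μ₂) / v) * x) := by
    rw [gaussianReal_eq_withDensity_exp μ₁ μ₂ hv]
    filter_upwards [Measure.rnDeriv_withDensity (gaussianReal μ₂ v)
      (f := fun x ↦ ENNReal.ofReal (exp ((μ₁ - μ₂) / v * x - (μ₁ ^ 2 - μ₂ ^ 2) / (2 * v))))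
      (by fun_prop)] with x hx
    rw [hx, ENNReal.toReal_ofReal (exp_nonneg _), ← exp_mul, ← exp_add]
    congr 1
    ring
  have hmgf := congrFun (mgf_fun_id_gaussianReal (μ := μ₂) (v := v)) (α * ((μ₁ - μ₂) / v))
  rw [mgf] at hmgf
  rw [renyiDiv, integral_congr_ae hderiv, integral_const_mul, hmgf, ← exp_add, log_exp]
  field_simp
  ring

theorem stmt19 (α μ₁ μ₂ σ : ℝ) (hα : 1 < α) (hσ : 0 < σ)
    (P Q : Measure ℝ)
    (hP : P = gaussianReal μ₁ (⟨σ ^ 2, sq_nonneg σ⟩ : NNReal))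
    (hQ : Q = gaussianReal μ₂ (⟨σ ^ 2, sq_nonneg σ⟩ : NNReal)) :
    P ≪ Q ∧ renyiDiv α P Q = α * (μ₁ - μ₂) ^ 2 / (2 * σ ^ 2) := by
  have hv : (⟨σ ^ 2, sq_nonneg σ⟩ : NNReal) ≠ 0 := fun h ↦
    (pow_pos hσ 2).ne' (congrArg NNReal.toReal h)
  subst hP hQ
  refine ⟨?_, renyiDiv_gaussianReal hα.ne' μ₁ μ₂ hv⟩
  rw [gaussianReal_eq_withDensity_exp μ₁ μ₂ hv]
  exact withDensity_absolutelyContinuous _ _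
end
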